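/- Let (m_j)_{j≥1} be an increasing sequence of positive integers such that m_j divides m_{j+1} for every j ≥ 1 and m_{j+1}/m_j → ∞ as j → ∞. Then the subgroup H₂ = {e^{2iπθ} : θ ∈ [0,1), Σ_{j≥1} ‖m_j θ‖² < ∞} of the unit circle is uncountable. -/

import Mathlib

/-- distance from a real number to the nearest integer -/
noncomputable def nint (t : ℝ) : ℝ := |t - round t|

lemma nint_nonneg (t : ℝ) : 0 ≤ nint t := abs_nonneg _

lemma nint_le_half (t : ℝ) : nint t ≤ 1 / 2 := abs_sub_round t

lemma nint_le_abs_sub_int (t : ℝ) (z : ℤ) : nint t ≤ |t - z| := round_le t z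

section Subsums

variable {u : ℕ → ℝ}

lemma le_mul_quarter_pow (hu : ∀ n, 4 * u (n + 1) ≤ u n) (n i : ℕ) :
    u (i + n) ≤ u n * (1 / 4) ^ i := by
  induction i with
  | zero => simp
  | succ i ih =>
    have h := hu (i + n)
    rw [show i + 1 + n = i + n + 1 by ring, pow_succ]
    linarith

lemma summable_of_four_mul_succ_le (hpos : ∀ n, 0 < u n) (hu : ∀ n, 4 * u (n + 1) ≤ u n) :
    Summable u :=
  Summable.of_nonneg_of_le (fun n => (hpos n).le) (le_mul_quarter_pow hu 0)
    ((summable_geometric_of_lt_one (by norm_num) (by norm_num)).mul_left _)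

lemma tsum_indicator_shift_le (hpos : ∀ n, 0 < u n) (hu : ∀ n, 4 * u (n + 1) ≤ u n)
    (s : Set ℕ) (n : ℕ) : ∑' i, s.indicator u (i + n) ≤ 4 / 3 * u n := by
  have hs : Summable (s.indicator u) := (summable_of_four_mul_succ_le hpos hu).indicator s
  have hg : Summable fun i : ℕ => u n * (1 / 4 : ℝ) ^ i :=
    (summable_geometric_of_lt_one (by norm_num) (by norm_num)).mul_left _
  calc ∑' i, s.indicator u (i + n) ≤ ∑' i : ℕ, u n * (1 / 4 : ℝ) ^ i :=
        ((summable_nat_add_iff n).2 hs).tsum_le_tsum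
          (fun i => (Set.indicator_le_self' (fun x _ => (hpos x).le) _).trans
            (le_mul_quarter_pow hu n i)) hg
    _ = 4 / 3 * u n := by
        rw [tsum_mul_left, tsum_geometric_of_lt_one (by norm_num) (by norm_num)]
        ring

/-- Distinct subseries of a series whose terms decrease by a factor at least four have
distinct sums. -/
lemma tsum_indicator_injective (hpos : ∀ n, 0 < u n) (hu : ∀ n, 4 * u (n + 1) ≤ u n) :
    Function.Injective fun s : Set ℕ => ∑' n, s.indicator u n := by
  have hsplit (s : Set ℕ) (n : ℕ) : ∑' i, s.indicator u (i + n) =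
      s.indicator u n + ∑' i, s.indicator u (i + (n + 1)) := by
    have hs : Summable (s.indicator u) := (summable_of_four_mul_succ_le hpos hu).indicator s
    rw [((summable_nat_add_iff n).2 hs).tsum_eq_zero_add]
    simp only [zero_add, add_right_comm, add_assoc]
  have htail_nonneg (s : Set ℕ) (n : ℕ) : 0 ≤ ∑' i, s.indicator u (i + n) :=
    tsum_nonneg fun i => Set.indicator_nonneg (fun x _ => (hpos x).le) _
  have htail_lt (s : Set ℕ) (n : ℕ) : ∑' i, s.indicator u (i + (n + 1)) < u n := by
    linarith [tsum_indicator_shift_le hpos hu s (n + 1), hu n, hpos n]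
  have hmem (s : Set ℕ) (n : ℕ) : n ∈ s ↔ u n ≤ ∑' i, s.indicator u (i + n) := by
    rw [hsplit]
    by_cases h : n ∈ s
    · simpa [h] using htail_nonneg s (n + 1)
    · simpa [h] using htail_lt s n
  intro s t hst
  have key (n : ℕ) : ∑' i, s.indicator u (i + n) = ∑' i, t.indicator u (i + n) := by
    induction n with
    | zero => simpa using hst
    | succ n ih =>
      have hn : n ∈ s ↔ n ∈ t := by rw [hmem, hmem, ih]
      have hi : s.indicator u n = t.indicator u n := by
        by_cases h : n ∈ s
        · simp [h, hn.1 h]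
        · simp [h, mt hn.2 h]
      rw [hsplit, hsplit t, hi] at ih
      exact add_left_cancel ih
  ext n
  rw [hmem, hmem, key]

end Subsums

lemma exp_two_pi_mul_I_injOn_Ico :
    Set.InjOn (fun θ : ℝ => Complex.exp (2 * (Real.pi : ℂ) * Complex.I * (θ : ℂ)))
      (Set.Ico 0 1) := by
  intro x hx y hy hxy
  obtain ⟨n, hn⟩ := Complex.exp_eq_exp_iff_exists_int.1 hxy
  have h : (x : ℂ) = y + n :=
    mul_left_cancel₀ Complex.two_pi_I_ne_zero (by linear_combination hn)
  have h' : x = y + n := by exact_mod_cast h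
  have h1 : (n : ℝ) < 1 := by linarith [hx.2, hy.1]
  have h2 : (-1 : ℝ) < n := by linarith [hx.1, hy.2]
  have h3 : n < 1 := by exact_mod_cast h1
  have h4 : -1 < n := by exact_mod_cast h2
  obtain rfl : n = 0 := by lia
  simpa using h'

section DivisibilityChain

variable {a : ℕ → ℕ}

lemma two_mul_le_succ_of_dvd (hpos : ∀ j, 0 < a j) (hmono : StrictMono a)
    (hdvd : ∀ j, a j ∣ a (j + 1)) (j : ℕ) : 2 * a j ≤ a (j + 1) := by
  obtain ⟨c, hc⟩ := hdvd j
  have h := hmono j.lt_succ_self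
  have := hpos j
  simp only [Nat.succ_eq_add_one] at h
  have : 2 ≤ c := by
    by_contra! hlt
    interval_cases c <;> lia
  rw [hc]
  nlinarith

lemma sum_range_succ_le_two_mul (h2 : ∀ j, 2 * a j ≤ a (j + 1)) (K : ℕ) :
    ∑ j ∈ Finset.range (K + 1), a j ≤ 2 * a K := by
  induction K with
  | zero => simp; lia
  | succ K ih =>
    rw [Finset.sum_range_succ]
    linarith [h2 K]

/-- If `k` picks indices at which the ratios of consecutive terms of a divisibility chain `a` grow
geometrically, then every subsum of `∑ 1 / a (k n + 1)` has summable distances `‖a j θ‖`. -/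
lemma summable_nint_mul_tsum_indicator (hpos : ∀ j, 0 < a j) (hmono : StrictMono a)
    (hdvd : ∀ j, a j ∣ a (j + 1)) {k : ℕ → ℕ} (hk : StrictMono k)
    (hratio : ∀ n, (4 : ℝ) ^ (n + 1) * a (k n) ≤ a (k n + 1))
    (hsum : Summable fun n => (a (k n + 1) : ℝ)⁻¹) (s : Set ℕ) :
    Summable fun j => nint (a j * ∑' n, s.indicator (fun n => (a (k n + 1) : ℝ)⁻¹) n) := by
  have hpos' (j : ℕ) : (0 : ℝ) < a j := by exact_mod_cast hpos j
  set v : ℕ → ℝ := s.indicator fun n => (a (k n + 1) : ℝ)⁻¹ with hv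
  have hvsum : Summable v := hsum.indicator s
  have hv0 (n : ℕ) : 0 ≤ v n := Set.indicator_nonneg (fun x _ => (inv_pos.2 (hpos' _)).le) n
  have hvle (n : ℕ) : v n ≤ (a (k n + 1) : ℝ)⁻¹ :=
    Set.indicator_le_self' (fun x _ => (inv_pos.2 (hpos' _)).le) n
  let c : ℕ × ℕ → ℝ := fun p => if p.2 ≤ k p.1 then a p.2 * v p.1 else 0
  have hc0 : 0 ≤ c := fun p => by
    dsimp only [c]
    split_ifs
    · exact mul_nonneg (hpos' _).le (hv0 _)
    · exact le_rfl
  have hcout (n j : ℕ) (hj : j ∉ Finset.range (k n + 1)) : c (n, j) = 0 := by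
    have : ¬ j ≤ k n := by simpa [Nat.lt_succ_iff] using hj
    simp [c, this]
  have hcsum : Summable c := by
    refine (summable_prod_of_nonneg hc0).2
      ⟨fun n => summable_of_ne_finset_zero (hcout n), ?_⟩
    have hg : Summable fun n : ℕ => 2 * (1 / 4 : ℝ) ^ (n + 1) :=
      ((summable_nat_add_iff 1).2
        (summable_geometric_of_lt_one (by norm_num) (by norm_num))).mul_left _
    refine Summable.of_nonneg_of_le (fun n => tsum_nonneg fun j => hc0 _) (fun n => ?_) hg
    rw [tsum_eq_sum (hcout n)]
    have h1 : ∑ j ∈ Finset.range (k n + 1), c (n, j) =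
        ((∑ j ∈ Finset.range (k n + 1), a j : ℕ) : ℝ) * v n := by
      rw [Nat.cast_sum, Finset.sum_mul]
      refine Finset.sum_congr rfl fun j hj => ?_
      have : j ≤ k n := by simpa [Nat.lt_succ_iff] using hj
      simp [c, this]
    have h2 : ((∑ j ∈ Finset.range (k n + 1), a j : ℕ) : ℝ) ≤ 2 * a (k n) := by
      exact_mod_cast sum_range_succ_le_two_mul (two_mul_le_succ_of_dvd hpos hmono hdvd) (k n)
    calc ∑ j ∈ Finset.range (k n + 1), c (n, j)
        ≤ 2 * a (k n) * (a (k n + 1) : ℝ)⁻¹ := by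
          rw [h1]
          exact mul_le_mul h2 (hvle n) (hv0 n) (by positivity)
      _ ≤ 2 * (1 / 4 : ℝ) ^ (n + 1) := by
          rw [← div_eq_mul_inv, div_le_iff₀ (hpos' _), one_div, inv_pow, mul_assoc]
          gcongr
          rw [← div_eq_inv_mul, le_div_iff₀ (by positivity)]
          linarith [hratio n]
  have hcswap := (Equiv.prodComm ℕ ℕ).summable_iff.2 hcsum
  refine Summable.of_nonneg_of_le (fun j => nint_nonneg _) (fun j => ?_) hcswap.prod
  have hcj : Summable fun n => c (n, j) := hcswap.prod_factor j
  have hcj0 : 0 ≤ ∑' n, c (n, j) := tsum_nonneg fun n => hc0 _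
  have hdiff (n : ℕ) : ∃ z : ℤ, (a j : ℝ) * v n - c (n, j) = z := by
    by_cases hj : j ≤ k n
    · exact ⟨0, by simp [c, hj]⟩
    by_cases hn : n ∈ s
    · obtain ⟨d, hd⟩ := Nat.le_induction (m := k n + 1) (P := fun i _ => a (k n + 1) ∣ a i)
        dvd_rfl (fun i _ hi => hi.trans (hdvd i)) j (by lia)
      refine ⟨d, ?_⟩
      have := (hpos' (k n + 1)).ne'
      simp only [c, hj, hv, hn, Set.indicator_of_mem, if_false, hd]
      push_cast
      field_simp
      ring
    · exact ⟨0, by simp [c, hj, hv, hn]⟩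
  choose z hz using hdiff
  have hzero (n : ℕ) (hn : n ∉ Finset.range j) : (a j : ℝ) * v n - c (n, j) = 0 := by
    have : j ≤ k n := (by simpa using hn : j ≤ n).trans (hk.id_le n)
    simp [c, this]
  have heq : (a j : ℝ) * ∑' n, v n - ∑' n, c (n, j) = (∑ n ∈ Finset.range j, z n : ℤ) := by
    rw [← tsum_mul_left, ← (hvsum.mul_left _).tsum_sub hcj, tsum_eq_sum hzero]
    push_cast
    exact Finset.sum_congr rfl fun n _ => hz n
  calc nint (a j * ∑' n, v n)
      ≤ |a j * ∑' n, v n - (∑ n ∈ Finset.range j, z n : ℤ)| := nint_le_abs_sub_int _ _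
    _ = ∑' n, c (n, j) := by rw [← heq, sub_sub_cancel, abs_of_nonneg hcj0]

end DivisibilityChain

/-- If `(m_j)` is an increasing sequence of positive integers with
`m_j ∣ m_{j+1}` for all `j` and `m_{j+1}/m_j → ∞`, then
`H₂ = {e^{2iπθ} : θ ∈ [0,1), ∑_j ‖m_j θ‖² < ∞}` is uncountable. -/
theorem stmt_11 (m : ℕ → ℕ) (hpos : ∀ j, 1 ≤ j → 0 < m j)
    (hmono : ∀ j, 1 ≤ j → m j < m (j + 1))
    (hdvd : ∀ j, 1 ≤ j → m j ∣ m (j + 1))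
    (hlim : Filter.Tendsto (fun j : ℕ => (m (j + 1) : ℝ) / (m j : ℝ))
      Filter.atTop Filter.atTop) :
    ¬ Set.Countable {z : ℂ | ∃ θ ∈ Set.Ico (0 : ℝ) 1,
        Summable (fun j : ℕ => nint ((m (j + 1) : ℝ) * θ) ^ 2) ∧
        z = Complex.exp (2 * (Real.pi : ℂ) * Complex.I * (θ : ℂ))} := by
  let a : ℕ → ℕ := fun j => m (j + 1)
  have ha0 (j : ℕ) : 0 < a j := hpos _ (by lia)
  have ha0' (j : ℕ) : (0 : ℝ) < a j := by exact_mod_cast ha0 j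
  have hamono : StrictMono a := strictMono_nat_of_lt_succ fun j => hmono _ (by lia)
  have hadvd (j : ℕ) : a j ∣ a (j + 1) := hdvd _ (by lia)
  have halim : Filter.Tendsto (fun j => (a (j + 1) : ℝ) / a j) Filter.atTop Filter.atTop :=
    (Filter.tendsto_add_atTop_iff_nat 1).2 hlim
  obtain ⟨k, hk, hratio⟩ := Filter.extraction_forall_of_eventually fun n : ℕ =>
    halim.eventually_ge_atTop ((4 : ℝ) ^ (n + 1))
  replace hratio (n : ℕ) : (4 : ℝ) ^ (n + 1) * a (k n) ≤ a (k n + 1) :=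
    (le_div_iff₀ (ha0' _)).1 (hratio n)
  have hfour (n : ℕ) : 4 * (a (k n) : ℝ) ≤ a (k n + 1) := by
    refine le_trans ?_ (hratio n)
    gcongr
    exact le_self_pow₀ (by norm_num) (by lia)
  let u : ℕ → ℝ := fun n => (a (k n + 1) : ℝ)⁻¹
  have hu0 (n : ℕ) : 0 < u n := inv_pos.2 (ha0' _)
  have hu (n : ℕ) : 4 * u (n + 1) ≤ u n := by
    have h1 : (a (k n + 1) : ℝ) ≤ a (k (n + 1)) := by
      exact_mod_cast hamono.monotone (hk n.lt_succ_self)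
    have h2 : 4 * (a (k n + 1) : ℝ) ≤ a (k (n + 1) + 1) := by linarith [hfour (n + 1)]
    dsimp only [u]
    rw [← div_eq_mul_inv, div_le_iff₀ (ha0' _), ← div_eq_inv_mul, le_div_iff₀ (ha0' _)]
    exact h2
  have hu_zero : u 0 ≤ 1 / 4 := by
    have h1 : (1 : ℝ) ≤ a (k 0) := by exact_mod_cast ha0 (k 0)
    dsimp only [u]
    rw [one_div]
    exact inv_anti₀ (by norm_num) (by linarith [hfour 0])
  let θ : Set ℕ → ℝ := fun s => ∑' n, s.indicator u n
  have hθ (s : Set ℕ) : θ s ∈ Set.Ico (0 : ℝ) 1 := by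
    refine ⟨tsum_nonneg fun n => Set.indicator_nonneg (fun x _ => (hu0 x).le) n, ?_⟩
    have h := tsum_indicator_shift_le hu0 hu s 0
    simp only [add_zero] at h
    dsimp only [θ]
    linarith
  intro hcount
  have hmaps : Set.MapsTo
      (fun s : Set ℕ => Complex.exp (2 * (Real.pi : ℂ) * Complex.I * (θ s : ℂ))) Set.univ
      {z : ℂ | ∃ θ ∈ Set.Ico (0 : ℝ) 1,
        Summable (fun j : ℕ => nint ((m (j + 1) : ℝ) * θ) ^ 2) ∧
        z = Complex.exp (2 * (Real.pi : ℂ) * Complex.I * (θ : ℂ))} := by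
    intro s _
    refine ⟨θ s, hθ s, ?_, rfl⟩
    have hsum := summable_nint_mul_tsum_indicator ha0 hamono hadvd hk hratio
      (summable_of_four_mul_succ_le hu0 hu) s
    refine Summable.of_nonneg_of_le (fun j => sq_nonneg _) (fun j => ?_) hsum
    exact pow_le_of_le_one (nint_nonneg _) ((nint_le_half _).trans (by norm_num)) two_ne_zero
  have hinj : Set.InjOn
      (fun s : Set ℕ => Complex.exp (2 * (Real.pi : ℂ) * Complex.I * (θ s : ℂ))) Set.univ :=
    fun s _ t _ hst =>
      tsum_indicator_injective hu0 hu (exp_two_pi_mul_I_injOn_Ico (hθ s) (hθ t) hst)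
  have : Countable (Set ℕ) :=
    Set.countable_univ_iff.1 (hmaps.countable_of_injOn hinj hcount)
  obtain ⟨f, hf⟩ := exists_injective_nat (Set ℕ)
  exact Function.cantor_injective f hf
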